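/- arXiv:0906.5313 — 3 statements merged into one kernel-verified Lean document; each statement's English description precedes it below -/
import Mathlib

section
/- Let δ ∈ ℂ with δ not a nonpositive integer, and let x be real with 0 < x < 1. Then the series Σ_{n=0}^∞ ((δ)_n / n!) · ( ψ(n+1) − ψ(δ+n) − ln x ) · x^n converges absolutely and ₂F₁(δ, 1; 1+δ; 1−x) = δ · Σ_{n=0}^∞ ((δ)_n / n!) ( ψ(n+1) − ψ(δ+n) − ln x ) x^n. -/
open Filter

/-- Pochhammer symbol `(a)ₙ = a(a+1)⋯(a+n-1)` for complex `a`. -/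
noncomputable def poch (a : ℂ) (n : ℕ) : ℂ := ∏ k ∈ Finset.range n, (a + k)

/-- Gauss hypergeometric series `₂F₁(a,b;c;x)`. -/
noncomputable def F21 (a b c x : ℂ) : ℂ :=
  ∑' n : ℕ, poch a n * poch b n / (poch c n * n.factorial) * x ^ n

/-- `D`-dimensional Legendre (Gegenbauer) function `P(z, ν, D)`. -/
noncomputable def legP (z ν : ℂ) (D : ℕ) : ℂ :=
  Complex.Gamma (ν + D - 2) / (Complex.Gamma (ν + 1) * Complex.Gamma ((D : ℂ) - 1)) *
    F21 (-ν) (ν + (D : ℂ) - 2) (((D : ℂ) - 1) / 2) ((1 - z) / 2)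

/-- Digamma function `ψ = Γ'/Γ`. -/
noncomputable def digamma (s : ℂ) : ℂ := deriv Complex.Gamma s / Complex.Gamma s


open scoped Topology

/-- The elementary factor of index `k` in the Weierstrass product of `1 / Γ`. -/
noncomputable def weierstrassFactor (k : ℕ) (s : ℂ) : ℂ :=
  (1 + s / (k + 1)) * Complex.exp (-(s / (k + 1)))

lemma norm_one_add_mul_exp_neg_sub_one_le (w : ℂ) :
    ‖(1 + w) * Complex.exp (-w) - 1‖ ≤ ‖w‖ ^ 2 * Real.exp ‖w‖ * Real.exp ‖w‖ := by
  have h := Complex.norm_exp_sub_sum_le_norm_mul_exp w 2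
  have e : (1 + w) * Complex.exp (-w) - 1 =
      -((Complex.exp w - ∑ m ∈ Finset.range 2, w ^ m / m.factorial) * Complex.exp (-w)) := by
    have : Complex.exp w * Complex.exp (-w) = 1 := by simp [← Complex.exp_add]
    simp only [Finset.sum_range_succ, Finset.sum_range_zero]
    simp
    linear_combination this
  rw [e, norm_neg, norm_mul]
  have h2 : ‖Complex.exp (-w)‖ ≤ Real.exp ‖w‖ := by
    simpa using Complex.norm_exp_le_exp_norm (-w)
  gcongr

lemma hasProdLocallyUniformlyOn_weierstrassFactor :
    HasProdLocallyUniformlyOn weierstrassFactor (fun s => ∏' k, weierstrassFactor k s)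
      Set.univ := by
  have e : weierstrassFactor = fun k s => 1 + (weierstrassFactor k s - 1) := by
    ext k s; ring
  rw [e]
  apply hasProdLocallyUniformlyOn_of_forall_compact isOpen_univ
  intro K _ hcK
  obtain ⟨R, hR⟩ := hcK.isBounded.exists_norm_le
  have hs : Summable fun k : ℕ => |R| ^ 2 * Real.exp |R| * Real.exp |R| * (1 / ((k : ℝ) + 1) ^ 2) := by
    have := (summable_nat_add_iff 1).mpr (Real.summable_one_div_nat_pow.mpr one_lt_two)
    exact (by simpa using this : Summable fun k : ℕ => 1 / ((k : ℝ) + 1) ^ 2).mul_left _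
  refine hs.hasProdUniformlyOn_nat_one_add hcK (.of_forall fun k s hsK ↦ ?_) (fun k ↦ ?_)
  · have hsR : ‖s‖ ≤ |R| := (hR s hsK).trans (le_abs_self R)
    have hk : (1 : ℝ) ≤ (k : ℝ) + 1 := by linarith [k.cast_nonneg (α := ℝ)]
    have hn : ‖s / ((k : ℂ) + 1)‖ = ‖s‖ / ((k : ℝ) + 1) := by
      rw [norm_div]; congr 1; exact_mod_cast Complex.norm_natCast (k + 1)
    have h1 : ‖s‖ / ((k : ℝ) + 1) ≤ |R| := (div_le_self (norm_nonneg _) hk).trans hsR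
    refine (norm_one_add_mul_exp_neg_sub_one_le _).trans ?_
    rw [hn]
    calc (‖s‖ / ((k : ℝ) + 1)) ^ 2 * Real.exp (‖s‖ / (k + 1)) * Real.exp (‖s‖ / (k + 1))
        ≤ (|R| / ((k : ℝ) + 1)) ^ 2 * Real.exp |R| * Real.exp |R| := by gcongr
      _ = _ := by field_simp
  · unfold weierstrassFactor; fun_prop

lemma ne_zero_of_forall_ne_neg {s : ℂ} (hs : ∀ m : ℕ, s ≠ -(m : ℂ)) : s ≠ 0 := by
  simpa using hs 0

lemma add_natCast_ne_zero {s : ℂ} (hs : ∀ m : ℕ, s ≠ -(m : ℂ)) (k : ℕ) : s + k ≠ 0 :=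
  fun h => hs k (eq_neg_of_add_eq_zero_left h)

lemma GammaSeq_mul_prod_weierstrassFactor {s : ℂ} (hs : ∀ m : ℕ, s ≠ -(m : ℂ)) {n : ℕ}
    (hn : n ≠ 0) :
    Complex.GammaSeq s n * (s * (∏ k ∈ Finset.range n, weierstrassFactor k s) *
      Complex.exp (s * ((harmonic n - Real.log n : ℝ) : ℂ))) = 1 := by
  have h0 := ne_zero_of_forall_ne_neg hs
  have hP : ∏ k ∈ Finset.range n, (s + ((k + 1 : ℕ) : ℂ)) ≠ 0 :=
    Finset.prod_ne_zero_iff.mpr fun k _ => add_natCast_ne_zero hs _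
  have hf : (n.factorial : ℂ) ≠ 0 := by exact_mod_cast n.factorial_ne_zero
  have e1 : ∏ k ∈ Finset.range n, weierstrassFactor k s =
      (∏ k ∈ Finset.range n, (s + ((k + 1 : ℕ) : ℂ))) / n.factorial *
        Complex.exp (-(s * (harmonic n : ℝ))) := by
    simp only [weierstrassFactor, Finset.prod_mul_distrib]
    congr 1
    · rw [← Finset.prod_range_add_one_eq_factorial, Nat.cast_prod, ← Finset.prod_div_distrib]
      refine Finset.prod_congr rfl fun k _ => ?_
      have : (k : ℂ) + 1 ≠ 0 := by exact_mod_cast k.succ_ne_zero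
      push_cast
      field_simp
      ring
    · rw [← Complex.exp_sum]
      congr 1
      simp [harmonic, Finset.mul_sum, div_eq_mul_inv]
  rw [e1, Complex.GammaSeq, Finset.prod_range_succ', Complex.cpow_def_of_ne_zero (by exact_mod_cast hn),
    ← Complex.natCast_log]
  have e2 : Complex.exp ((Real.log n : ℂ) * s) * (Complex.exp (-(s * (harmonic n : ℝ))) *
      Complex.exp (s * ((harmonic n - Real.log n : ℝ) : ℂ))) = 1 := by
    rw [← Complex.exp_add, ← Complex.exp_add]
    push_cast
    ring_nf
    simp
  simp only [Nat.cast_zero, add_zero]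
  field_simp
  linear_combination e2

lemma tprod_weierstrassFactor {s : ℂ} (hs : ∀ m : ℕ, s ≠ -(m : ℂ)) :
    ∏' k, weierstrassFactor k s =
      (Complex.Gamma s * s * Complex.exp (s * Real.eulerMascheroniConstant))⁻¹ := by
  have h1 := (hasProdLocallyUniformlyOn_weierstrassFactor.hasProd (Set.mem_univ s)).tendsto_prod_nat
  have h2 := Real.tendsto_harmonic_sub_log
  have h3 : Tendsto (fun n : ℕ => Complex.exp (s * ((harmonic n - Real.log n : ℝ) : ℂ))) atTop
      (𝓝 (Complex.exp (s * Real.eulerMascheroniConstant))) :=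
    (Complex.continuous_exp.tendsto _).comp
      (((Complex.continuous_ofReal.tendsto _).comp h2).const_mul s)
  have h4 := (Complex.GammaSeq_tendsto_Gamma s).mul ((h1.const_mul s).mul h3)
  have h5 := tendsto_nhds_unique (h4.congr' ((eventually_ne_atTop 0).mono fun n hn =>
    GammaSeq_mul_prod_weierstrassFactor hs hn)) tendsto_const_nhds
  exact eq_inv_of_mul_eq_one_left (by linear_combination h5)

lemma logDeriv_weierstrassFactor {s : ℂ} (hs : ∀ m : ℕ, s ≠ -(m : ℂ)) (k : ℕ) :
    logDeriv (weierstrassFactor k) s = 1 / (s + (k + 1)) - 1 / (k + 1) := by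
  have hk : (k : ℂ) + 1 ≠ 0 := by exact_mod_cast k.succ_ne_zero
  have hsk : s + (k + 1) ≠ 0 := by exact_mod_cast add_natCast_ne_zero hs (k + 1)
  have hd : HasDerivAt (fun s : ℂ => s / (k + 1)) (1 / (k + 1)) s := (hasDerivAt_id s).div_const _
  have hw : HasDerivAt (weierstrassFactor k) _ s := (hd.const_add 1).mul hd.fun_neg.cexp
  rw [logDeriv_apply, hw.deriv, weierstrassFactor]
  have hx : 1 + s / (k + 1) ≠ 0 := by
    rw [show 1 + s / ((k : ℂ) + 1) = (s + (k + 1)) / (k + 1) by field_simp; ring]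
    exact div_ne_zero hsk hk
  have := Complex.exp_ne_zero (-(s / ((k : ℂ) + 1)))
  rw [div_eq_iff (mul_ne_zero hx this)]
  field_simp
  ring

lemma tendsto_sum_digamma {s : ℂ} (hs : ∀ m : ℕ, s ≠ -(m : ℂ)) :
    Tendsto (fun n : ℕ => ∑ k ∈ Finset.range n, (1 / (s + (k + 1)) - 1 / ((k : ℂ) + 1))) atTop
      (𝓝 (-digamma s - 1 / s - Real.eulerMascheroniConstant)) := by
  have h0 := ne_zero_of_forall_ne_neg hs
  have hG := Complex.Gamma_ne_zero hs
  have hdG := Complex.differentiableAt_Gamma s hs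
  have hev : (fun s => ∏' k, weierstrassFactor k s) =ᶠ[𝓝 s] fun s =>
      1 / (Complex.Gamma s * (s * Complex.exp (s * Real.eulerMascheroniConstant))) := by
    have : ∀ᶠ z in 𝓝 s, (Complex.Gamma z)⁻¹ ≠ 0 :=
      Complex.differentiable_one_div_Gamma.continuous.continuousAt.eventually_ne (inv_ne_zero hG)
    filter_upwards [this] with z hz
    rw [tprod_weierstrassFactor fun m hm => hz (by rw [hm, Complex.Gamma_neg_nat_eq_zero, inv_zero]),
      one_div, mul_assoc]
  have hP : ∏' k, weierstrassFactor k s ≠ 0 := by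
    rw [tprod_weierstrassFactor hs]
    exact inv_ne_zero (mul_ne_zero (mul_ne_zero hG h0) (Complex.exp_ne_zero _))
  have hlim := Complex.logDeriv_tendsto isOpen_univ (Set.mem_univ s)
    hasProdLocallyUniformlyOn_weierstrassFactor
    (.of_forall fun b => by unfold weierstrassFactor; fun_prop) hP
  have hd : ∀ k, DifferentiableAt ℂ (weierstrassFactor k) s := fun k => by
    unfold weierstrassFactor; fun_prop
  have hne : ∀ k, weierstrassFactor k s ≠ 0 := fun k hk => hP (tprod_of_exists_eq_zero ⟨k, hk⟩)
  have hlog : logDeriv (fun s => ∏' k, weierstrassFactor k s) s =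
      -digamma s - 1 / s - Real.eulerMascheroniConstant := by
    have hde : HasDerivAt (fun s : ℂ => Complex.exp (s * Real.eulerMascheroniConstant)) _ s :=
      ((hasDerivAt_id s).mul_const _).cexp
    have hE := Complex.exp_ne_zero (s * Real.eulerMascheroniConstant)
    rw [(logDeriv_congr_nhds hev).self_of_nhds,
      logDeriv_div (f := fun _ => (1 : ℂ))
        (g := fun s => Complex.Gamma s * (s * Complex.exp (s * Real.eulerMascheroniConstant))) s
        one_ne_zero (mul_ne_zero hG (mul_ne_zero h0 hE)) (by fun_prop) (by fun_prop),
      logDeriv_mul (f := Complex.Gamma)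
        (g := fun s => s * Complex.exp (s * Real.eulerMascheroniConstant)) s hG
        (mul_ne_zero h0 hE) hdG (by fun_prop),
      logDeriv_mul (f := fun s => s)
        (g := fun s => Complex.exp (s * Real.eulerMascheroniConstant)) s h0 hE (by fun_prop)
        (by fun_prop), logDeriv_id', logDeriv_const,
      logDeriv_apply, logDeriv_apply, hde.deriv, digamma]
    simp [hE]
    ring
  rw [hlog] at hlim
  refine (hlim.comp tendsto_finset_range).congr fun n => ?_
  rw [Function.comp, logDeriv_prod (fun k _ => hne k) (fun k _ => hd k)]
  exact Finset.sum_congr rfl fun k _ => logDeriv_weierstrassFactor hs k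

lemma digamma_add_one {s : ℂ} (hs : ∀ m : ℕ, s ≠ -(m : ℂ)) :
    digamma (s + 1) = digamma s + 1 / s := by
  rw [one_div]; exact Complex.digamma_apply_add_one s hs

lemma digamma_one : digamma 1 = -Real.eulerMascheroniConstant := Complex.digamma_one

lemma digamma_add_natCast {s : ℂ} (hs : ∀ m : ℕ, s ≠ -(m : ℂ)) (n : ℕ) :
    digamma (s + n) = digamma s + ∑ k ∈ Finset.range n, 1 / (s + k) := by
  induction n with
  | zero => simp
  | succ n ih =>
    rw [Finset.sum_range_succ, ← add_assoc, ← ih, Nat.cast_succ, ← add_assoc, digamma_add_one]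
    intro m hm
    refine hs (n + m) ?_
    push_cast
    linear_combination hm

lemma one_ne_neg_natCast (m : ℕ) : (1 : ℂ) ≠ -(m : ℂ) := by
  intro h
  have : ((1 + m : ℕ) : ℂ) = 0 := by push_cast; linear_combination h
  have := Nat.cast_eq_zero.mp this
  lia

lemma tendsto_one_div_add_natCast (s : ℂ) :
    Tendsto (fun n : ℕ => 1 / (s + n)) atTop (𝓝 0) := by
  have : Tendsto (fun n : ℕ => s + (n : ℂ)) atTop (Bornology.cobounded ℂ) :=
    (tendsto_const_add_cobounded s).comp (tendsto_natCast_atTop_cobounded)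
  simpa [Function.comp_def] using tendsto_inv₀_cobounded.comp this

lemma tendsto_sum_one_div_sub_one_div {s : ℂ} (hs : ∀ m : ℕ, s ≠ -(m : ℂ)) :
    Tendsto (fun n : ℕ => ∑ k ∈ Finset.range n, (1 / (s + k) - 1 / ((k : ℂ) + 1))) atTop
      (𝓝 (digamma 1 - digamma s)) := by
  have h := ((tendsto_sum_digamma hs).add_const (1 / s)).sub (tendsto_one_div_add_natCast s)
  rw [digamma_one]
  refine (h.congr fun n => ?_).trans_eq (by ring_nf)
  have e := Finset.sum_range_succ (fun k : ℕ => 1 / (s + k)) n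
  rw [Finset.sum_range_succ'] at e
  rw [Finset.sum_sub_distrib, Finset.sum_sub_distrib]
  push_cast at e
  rw [add_zero] at e
  linear_combination e

lemma digamma_sub_digamma_succ {s : ℂ} (hs : ∀ m : ℕ, s ≠ -(m : ℂ)) (n : ℕ) :
    digamma (((n + 1 : ℕ) : ℂ) + 1) - digamma (s + (n + 1 : ℕ)) =
      digamma ((n : ℂ) + 1) - digamma (s + n) + 1 / ((n : ℂ) + 1) - 1 / (s + n) := by
  rw [add_comm ((n + 1 : ℕ) : ℂ) 1, add_comm (n : ℂ) 1, digamma_add_natCast hs,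
    digamma_add_natCast hs, digamma_add_natCast one_ne_neg_natCast,
    digamma_add_natCast one_ne_neg_natCast, Finset.sum_range_succ, Finset.sum_range_succ]
  ring

lemma tendsto_digamma_sub_digamma {s : ℂ} (hs : ∀ m : ℕ, s ≠ -(m : ℂ)) :
    Tendsto (fun n : ℕ => digamma ((n : ℂ) + 1) - digamma (s + n)) atTop (𝓝 0) := by
  have h := (tendsto_sum_one_div_sub_one_div hs).const_sub (digamma 1 - digamma s)
  rw [sub_self] at h
  refine h.congr fun n => ?_
  rw [add_comm _ 1, digamma_add_natCast hs, digamma_add_natCast one_ne_neg_natCast,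
    Finset.sum_sub_distrib]
  simp only [add_comm (1 : ℂ)]
  ring

/-- The power series with coefficients `a` converges absolutely on the open unit disk. -/
def AbsConvOnDisk (a : ℕ → ℂ) : Prop :=
  ∀ r : ℝ, 0 ≤ r → r < 1 → Summable fun n => ‖a n‖ * r ^ n

lemma AbsConvOnDisk.summable_norm {a : ℕ → ℂ} (ha : AbsConvOnDisk a) {z : ℂ} (hz : ‖z‖ < 1) :
    Summable fun n => ‖a n * z ^ n‖ := by
  simpa using ha ‖z‖ (norm_nonneg z) hz

lemma AbsConvOnDisk.hasSum {a : ℕ → ℂ} (ha : AbsConvOnDisk a) {z : ℂ} (hz : ‖z‖ < 1) :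
    HasSum (fun n => a n * z ^ n) (∑' n, a n * z ^ n) :=
  (ha.summable_norm hz).of_norm.hasSum

lemma AbsConvOnDisk.mul_of_tendsto {a b : ℕ → ℂ} (ha : AbsConvOnDisk a) {l : ℂ}
    (hb : Tendsto b atTop (𝓝 l)) : AbsConvOnDisk fun n => a n * b n := by
  obtain ⟨C, hC⟩ := hb.norm.bddAbove_range
  intro r h0 h1
  refine Summable.of_nonneg_of_le (fun n => by positivity) (fun n => ?_) ((ha r h0 h1).mul_left C)
  have : ‖b n‖ ≤ C := hC ⟨n, rfl⟩
  have := mul_le_mul_of_nonneg_left this (show 0 ≤ ‖a n‖ * r ^ n by positivity)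
  rw [norm_mul]
  linarith

lemma absConvOnDisk_of_tendsto {a : ℕ → ℂ} {l : ℂ} (ha : Tendsto a atTop (𝓝 l)) :
    AbsConvOnDisk a := by
  have h1 : AbsConvOnDisk fun _ => 1 := fun r h0 h1 => by
    simpa using summable_geometric_of_lt_one h0 h1
  simpa using h1.mul_of_tendsto ha

lemma AbsConvOnDisk.exists_hasDerivAt {a : ℕ → ℂ} (ha : AbsConvOnDisk a) {z : ℂ} (hz : ‖z‖ < 1) :
    ∃ d, HasDerivAt (fun w => ∑' n, a n * w ^ n) d z ∧
      HasSum (fun n : ℕ => (n + 1) * a (n + 1) * z ^ n) d ∧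
      HasSum (fun n : ℕ => n * a n * z ^ n) (z * d) := by
  obtain ⟨r, hzr, hr⟩ := exists_between hz
  have hr0 : 0 ≤ r := (norm_nonneg z).trans hzr.le
  have hd : ∀ n, DifferentiableOn ℂ (fun w => a n * w ^ n) (Metric.ball 0 r) :=
    fun n => by fun_prop
  have hle : ∀ n, ∀ w ∈ Metric.ball (0 : ℂ) r, ‖a n * w ^ n‖ ≤ ‖a n‖ * r ^ n := by
    intro n w hw
    rw [norm_mul, norm_pow]
    have : ‖w‖ ≤ r := (mem_ball_zero_iff.mp hw).le
    gcongr
  have hmem : z ∈ Metric.ball (0 : ℂ) r := mem_ball_zero_iff.mpr hzr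
  have h := Complex.hasSum_deriv_of_summable_norm (ha r hr0 hr) hd Metric.isOpen_ball hle hmem
  have hD := Complex.differentiableOn_tsum_of_summable_norm (ha r hr0 hr) hd Metric.isOpen_ball hle
  have he : ∀ n, deriv (fun w => a n * w ^ n) z = a n * (n * z ^ (n - 1)) := fun n => by simp
  simp only [he] at h
  refine ⟨_, (hD.differentiableAt (Metric.isOpen_ball.mem_nhds hmem)).hasDerivAt, ?_, ?_⟩
  · have := (hasSum_nat_add_iff' 1).mpr h
    simp only [Finset.sum_range_one, Nat.cast_zero, zero_mul, mul_zero, sub_zero] at this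
    refine this.congr_fun fun n => ?_
    push_cast
    ring
  · refine (h.mul_left z).congr_fun fun n => ?_
    cases n with
    | zero => simp
    | succ n => rw [Nat.add_sub_cancel]; ring

lemma poch_succ (a : ℂ) (n : ℕ) : poch a (n + 1) = poch a n * (a + n) :=
  Finset.prod_range_succ _ _

lemma poch_succ' (a : ℂ) (n : ℕ) : poch a (n + 1) = a * poch (1 + a) n := by
  rw [poch, Finset.prod_range_succ', poch, mul_comm]
  congr 1
  · simp
  · exact Finset.prod_congr rfl fun k _ => by push_cast; ring

lemma poch_one (n : ℕ) : poch 1 n = n.factorial := by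
  rw [poch, ← Finset.prod_range_add_one_eq_factorial, Nat.cast_prod]
  exact Finset.prod_congr rfl fun k _ => by push_cast; ring

lemma poch_ne_zero {a : ℂ} (ha : ∀ m : ℕ, a ≠ -(m : ℂ)) (n : ℕ) : poch a n ≠ 0 :=
  Finset.prod_ne_zero_iff.mpr fun k _ => add_natCast_ne_zero ha k

lemma poch_div_factorial_succ (a : ℂ) (n : ℕ) :
    (n + 1) * (poch a (n + 1) / (n + 1).factorial) = (a + n) * (poch a n / n.factorial) := by
  have h1 : (n : ℂ) + 1 ≠ 0 := by exact_mod_cast n.succ_ne_zero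
  have h2 : (n.factorial : ℂ) ≠ 0 := by exact_mod_cast n.factorial_ne_zero
  rw [poch_succ, Nat.factorial_succ]
  push_cast
  field_simp

lemma absConvOnDisk_poch_div_factorial {a : ℂ} (ha : ∀ m : ℕ, a ≠ -(m : ℂ)) :
    AbsConvOnDisk fun n => poch a n / n.factorial := by
  intro r h0 h1
  rcases h0.eq_or_lt with rfl | hr
  · exact summable_of_ne_finset_zero (s := {0}) fun n hn => by simp_all
  have hc : ∀ n : ℕ, poch a n / n.factorial ≠ 0 := fun n =>
    div_ne_zero (poch_ne_zero ha n) (by exact_mod_cast n.factorial_ne_zero)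
  have hlim : Tendsto (fun n : ℕ => ‖1 + (a - 1) * (1 / (1 + (n : ℂ)))‖ * r) atTop (𝓝 r) := by
    have := ((((tendsto_one_div_add_natCast 1).const_mul (a - 1)).const_add 1).norm).mul_const r
    simpa using this
  refine summable_of_ratio_test_tendsto_lt_one h1
    (.of_forall fun n => mul_ne_zero (norm_ne_zero_iff.mpr (hc n)) (pow_pos hr n).ne')
    (hlim.congr fun n => ?_)
  have h1 : (1 : ℂ) + n ≠ 0 := by rw [add_comm]; exact_mod_cast n.succ_ne_zero
  have e : poch a (n + 1) / (n + 1).factorial =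
      (1 + (a - 1) * (1 / (1 + (n : ℂ)))) * (poch a n / n.factorial) := by
    apply mul_left_cancel₀ h1
    rw [add_comm 1 (n : ℂ), poch_div_factorial_succ] at *
    field_simp
    ring
  have h3 := norm_ne_zero_iff.mpr (hc n)
  beta_reduce
  simp only [e, norm_mul, norm_pow, norm_norm, Real.norm_of_nonneg h0, pow_succ]
  have := (pow_pos hr n).ne'
  rw [eq_div_iff (mul_ne_zero h3 this)]
  ring

lemma norm_ofReal_lt_one {x : ℝ} (hx : x ∈ Set.Ioo (0 : ℝ) 1) : ‖(x : ℂ)‖ < 1 := by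
  rw [Complex.norm_of_nonneg hx.1.le]; exact hx.2

lemma one_sub_mem_Ioo {x : ℝ} (hx : x ∈ Set.Ioo (0 : ℝ) 1) : 1 - x ∈ Set.Ioo (0 : ℝ) 1 :=
  ⟨by linarith [hx.2], by linarith [hx.1]⟩

lemma tsum_mul_zero_pow (a : ℕ → ℂ) : ∑' n, a n * (0 : ℂ) ^ n = a 0 := by
  rw [tsum_eq_single 0 fun n hn => by simp [hn]]
  simp

section Connection

variable {δ : ℂ}

/-- The coefficients of `(1 - z) ^ (-δ)`. -/
noncomputable def binomCoeff (δ : ℂ) (n : ℕ) : ℂ := poch δ n / n.factorial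

/-- The coefficients of the logarithm-free part of the connection formula. -/
noncomputable def digammaCoeff (δ : ℂ) (n : ℕ) : ℂ :=
  binomCoeff δ n * (digamma ((n : ℂ) + 1) - digamma (δ + n))

lemma absConvOnDisk_binomCoeff (hδ : ∀ m : ℕ, δ ≠ -(m : ℂ)) : AbsConvOnDisk (binomCoeff δ) :=
  absConvOnDisk_poch_div_factorial hδ

lemma absConvOnDisk_digammaCoeff (hδ : ∀ m : ℕ, δ ≠ -(m : ℂ)) : AbsConvOnDisk (digammaCoeff δ) :=
  (absConvOnDisk_binomCoeff hδ).mul_of_tendsto (tendsto_digamma_sub_digamma hδ)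

lemma absConvOnDisk_one_div_add (δ : ℂ) : AbsConvOnDisk fun n => 1 / (δ + n) :=
  absConvOnDisk_of_tendsto (tendsto_one_div_add_natCast δ)

lemma binomCoeff_zero : binomCoeff δ 0 = 1 := by simp [binomCoeff, poch]

lemma binomCoeff_succ (n : ℕ) : (n + 1) * binomCoeff δ (n + 1) = (δ + n) * binomCoeff δ n :=
  poch_div_factorial_succ δ n

lemma digammaCoeff_succ (hδ : ∀ m : ℕ, δ ≠ -(m : ℂ)) (n : ℕ) :
    (n + 1) * digammaCoeff δ (n + 1) =
      (δ + n) * digammaCoeff δ n + binomCoeff δ (n + 1) - binomCoeff δ n := by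
  have h1 : (n : ℂ) + 1 ≠ 0 := by exact_mod_cast n.succ_ne_zero
  have h2 := add_natCast_ne_zero hδ n
  have h3 := binomCoeff_succ (δ := δ) n
  have h4 : 1 / ((n : ℂ) + 1) * ((n + 1) * binomCoeff δ (n + 1)) = binomCoeff δ (n + 1) := by
    field_simp
  have h5 : 1 / (δ + n) * ((δ + n) * binomCoeff δ n) = binomCoeff δ n := by field_simp
  unfold digammaCoeff
  rw [digamma_sub_digamma_succ hδ]
  linear_combination (digamma (n + 1) - digamma (δ + n) - 1 / (δ + n)) * h3 + h4 - h5

lemma hasDerivAt_tsum_binomCoeff (hδ : ∀ m : ℕ, δ ≠ -(m : ℂ)) {z : ℂ} (hz : ‖z‖ < 1) :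
    HasDerivAt (fun w => ∑' n, binomCoeff δ n * w ^ n)
      (δ / (1 - z) * ∑' n, binomCoeff δ n * z ^ n) z := by
  obtain ⟨d, hd, h1, h2⟩ := (absConvOnDisk_binomCoeff hδ).exists_hasDerivAt hz
  have h := (absConvOnDisk_binomCoeff hδ).hasSum hz
  have e : d = δ * (∑' n, binomCoeff δ n * z ^ n) + z * d := by
    refine h1.unique (((h.mul_left δ).add h2).congr_fun fun n => ?_)
    rw [binomCoeff_succ]; ring
  have hz1 : 1 - z ≠ 0 := sub_ne_zero.mpr fun h => by simp [← h] at hz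
  convert! hd using 1
  field_simp
  linear_combination -e

lemma hasDerivAt_tsum_digammaCoeff (hδ : ∀ m : ℕ, δ ≠ -(m : ℂ)) {z : ℂ} (hz : ‖z‖ < 1)
    (hz0 : z ≠ 0) :
    HasDerivAt (fun w => ∑' n, digammaCoeff δ n * w ^ n)
      ((δ * (∑' n, digammaCoeff δ n * z ^ n) +
        ((∑' n, binomCoeff δ n * z ^ n) - 1) / z - ∑' n, binomCoeff δ n * z ^ n) / (1 - z)) z := by
  obtain ⟨d, hd, h1, h2⟩ := (absConvOnDisk_digammaCoeff hδ).exists_hasDerivAt hz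
  have hA := (absConvOnDisk_digammaCoeff hδ).hasSum hz
  have hB := (absConvOnDisk_binomCoeff hδ).hasSum hz
  have hB' : HasSum (fun n => binomCoeff δ (n + 1) * z ^ n)
      (((∑' n, binomCoeff δ n * z ^ n) - 1) / z) := by
    have := ((hasSum_nat_add_iff' 1).mpr hB).div_const z
    simp only [Finset.sum_range_one, pow_zero, mul_one, binomCoeff_zero] at this
    refine this.congr_fun fun n => ?_
    field_simp
    ring
  have e : d = _ := h1.unique
    ((((hA.mul_left δ).add h2).add hB').sub hB |>.congr_fun fun n => by
      rw [digammaCoeff_succ hδ]; ring)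
  have hz1 : 1 - z ≠ 0 := sub_ne_zero.mpr fun h => by simp [← h] at hz
  convert! hd using 1
  rw [div_eq_iff hz1]
  linear_combination -e

lemma hasDerivAt_tsum_one_div_add (hδ : ∀ m : ℕ, δ ≠ -(m : ℂ)) {z : ℂ} (hz : ‖z‖ < 1)
    (hz0 : z ≠ 0) :
    HasDerivAt (fun w => ∑' n : ℕ, 1 / (δ + n) * w ^ n)
      ((1 / (1 - z) - δ * ∑' n : ℕ, 1 / (δ + n) * z ^ n) / z) z := by
  obtain ⟨d, hd, h1, h2⟩ := (absConvOnDisk_one_div_add δ).exists_hasDerivAt hz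
  have h := (absConvOnDisk_one_div_add δ).hasSum hz
  have e : (1 - z)⁻¹ = δ * (∑' n : ℕ, 1 / (δ + n) * z ^ n) + z * d := by
    refine (hasSum_geometric_of_norm_lt_one hz).unique
      (((h.mul_left δ).add h2).congr_fun fun n => ?_)
    have := add_natCast_ne_zero hδ n
    field_simp
  convert! hd using 1
  rw [div_eq_iff hz0, one_div]
  linear_combination e

/-- The difference of the two sides of the connection formula, divided by `δ`. -/
noncomputable def connectionDefect (δ : ℂ) (x : ℝ) : ℂ :=
  (∑' n : ℕ, 1 / (δ + n) * (1 - (x : ℂ)) ^ n) -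
    ((∑' n, digammaCoeff δ n * (x : ℂ) ^ n) -
      (Real.log x : ℂ) * ∑' n, binomCoeff δ n * (x : ℂ) ^ n)

lemma hasDerivAt_connectionDefect (hδ : ∀ m : ℕ, δ ≠ -(m : ℂ)) {x : ℝ}
    (hx : x ∈ Set.Ioo (0 : ℝ) 1) :
    HasDerivAt (connectionDefect δ) (δ / (1 - (x : ℂ)) * connectionDefect δ x) x := by
  have hx0 : (x : ℂ) ≠ 0 := by exact_mod_cast hx.1.ne'
  have hx1 : (1 : ℂ) - x ≠ 0 := by exact_mod_cast (sub_pos.mpr hx.2).ne'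
  have hn := norm_ofReal_lt_one hx
  have hn' : ‖(1 : ℂ) - x‖ < 1 := by simpa using norm_ofReal_lt_one (one_sub_mem_Ioo hx)
  have hL := ((hasDerivAt_tsum_one_div_add hδ hn' hx1).comp (x : ℂ)
    ((hasDerivAt_id (x : ℂ)).const_sub 1)).comp_ofReal
  have hA := (hasDerivAt_tsum_digammaCoeff hδ hn hx0).comp_ofReal
  have hB := (hasDerivAt_tsum_binomCoeff hδ hn).comp_ofReal
  have hlog := (Real.hasDerivAt_log hx.1.ne').ofReal_comp
  rw [sub_sub_cancel] at hL
  have h := hL.sub (hA.sub (hlog.mul hB))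
  convert! h using 1
  simp only [connectionDefect]
  push_cast
  field_simp
  ring

lemma tendsto_connectionDefect (hδ : ∀ m : ℕ, δ ≠ -(m : ℂ)) :
    Tendsto (connectionDefect δ) (𝓝[>] 0) (𝓝 0) := by
  have hIoo : ∀ᶠ x : ℝ in 𝓝[>] 0, x ∈ Set.Ioo (0 : ℝ) 1 := Ioo_mem_nhdsGT one_pos
  have hof : Tendsto (fun x : ℝ => (x : ℂ)) (𝓝[>] 0) (𝓝 0) := by
    simpa using (Complex.continuous_ofReal.tendsto 0).mono_left nhdsWithin_le_nhds
  have hofne : Tendsto (fun x : ℝ => (x : ℂ)) (𝓝[>] 0) (𝓝[≠] 0) :=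
    tendsto_nhdsWithin_iff.mpr ⟨hof, hIoo.mono fun x hx => by simpa using hx.1.ne'⟩
  have hsub : Tendsto (fun x : ℝ => 1 - x) (𝓝[>] 0) (𝓝[<] 1) := by
    refine tendsto_nhdsWithin_iff.mpr ⟨?_, hIoo.mono fun x hx => by simpa using hx.1⟩
    have : Continuous fun x : ℝ => 1 - x := by fun_prop
    simpa using (this.tendsto 0).mono_left (nhdsWithin_le_nhds (s := Set.Ioi 0))
  have hS : Tendsto (fun x : ℝ => ∑' n : ℕ, (1 / (δ + n) - 1 / ((n : ℂ) + 1)) *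
      (1 - (x : ℂ)) ^ n) (𝓝[>] 0) (𝓝 (digamma 1 - digamma δ)) := by
    have := (tendsto_map'_iff.mp (Complex.tendsto_tsum_powerSeries_nhdsWithin_lt
      (tendsto_sum_one_div_sub_one_div hδ))).comp hsub
    simpa [Function.comp_def] using this
  have hA : Tendsto (fun x : ℝ => ∑' n, digammaCoeff δ n * (x : ℂ) ^ n) (𝓝[>] 0)
      (𝓝 (digamma 1 - digamma δ)) := by
    obtain ⟨d, hd, -⟩ := (absConvOnDisk_digammaCoeff hδ).exists_hasDerivAt (z := 0) (by simp)
    have := hd.continuousAt.tendsto.comp hof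
    simpa [Function.comp_def, tsum_mul_zero_pow, digammaCoeff, binomCoeff_zero] using this
  have hxlog : Tendsto (fun x : ℝ => ((x * Real.log x : ℝ) : ℂ)) (𝓝[>] 0) (𝓝 0) := by
    have := ((Complex.continuous_ofReal.comp Real.continuous_mul_log).tendsto 0).mono_left
      (nhdsWithin_le_nhds (s := Set.Ioi 0))
    simpa [Function.comp_def] using this
  have hB : ∃ d, Tendsto (fun x : ℝ => ((∑' n, binomCoeff δ n * (x : ℂ) ^ n) - 1) / x) (𝓝[>] 0)
      (𝓝 d) := by
    obtain ⟨d, hd, -⟩ := (absConvOnDisk_binomCoeff hδ).exists_hasDerivAt (z := 0) (by simp)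
    refine ⟨d, ((hasDerivAt_iff_tendsto_slope.mp hd).comp hofne).congr fun x => ?_⟩
    simp [slope_def_field, tsum_mul_zero_pow, binomCoeff_zero]
  obtain ⟨d, hB⟩ := hB
  have hdiv : Tendsto (fun x : ℝ => ((x * Real.log x : ℝ) : ℂ) / (1 - (x : ℂ))) (𝓝[>] 0) (𝓝 0) := by
    simpa [Pi.div_def] using hxlog.div (hof.const_sub 1) (by simp)
  have key := ((hS.sub hdiv).sub hA).add (hxlog.mul hB)
  rw [show digamma 1 - digamma δ - 0 - (digamma 1 - digamma δ) + 0 * d = 0 by ring] at key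
  refine key.congr' (hIoo.mono fun x hx => ?_)
  have hx0 : (x : ℂ) ≠ 0 := by exact_mod_cast hx.1.ne'
  have hx1 : (1 : ℂ) - x ≠ 0 := by exact_mod_cast (sub_pos.mpr hx.2).ne'
  have hn' : ‖(1 : ℂ) - x‖ < 1 := by simpa using norm_ofReal_lt_one (one_sub_mem_Ioo hx)
  have hlog : HasSum (fun n : ℕ => 1 / ((n : ℂ) + 1) * (1 - (x : ℂ)) ^ n)
      (-(Real.log x : ℂ) / (1 - (x : ℂ))) := by
    have := Real.hasSum_pow_div_log_of_abs_lt_one (x := 1 - x)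
      (by rw [abs_of_pos (one_sub_mem_Ioo hx).1]; exact (one_sub_mem_Ioo hx).2)
    have := (Complex.hasSum_ofReal.mpr this).div_const (1 - (x : ℂ))
    rw [sub_sub_cancel, Complex.ofReal_neg] at this
    refine this.congr_fun fun n => ?_
    push_cast
    field_simp
    ring
  have hL := (absConvOnDisk_one_div_add δ).hasSum hn'
  have hSx : ∑' n : ℕ, (1 / (δ + n) - 1 / ((n : ℂ) + 1)) * (1 - (x : ℂ)) ^ n =
      (∑' n : ℕ, 1 / (δ + n) * (1 - (x : ℂ)) ^ n) - -(Real.log x : ℂ) / (1 - (x : ℂ)) :=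
    ((hL.sub hlog).congr_fun fun n => by ring).tsum_eq
  rw [hSx, connectionDefect]
  push_cast
  field_simp
  ring

lemma connectionDefect_eq_zero (hδ : ∀ m : ℕ, δ ≠ -(m : ℂ)) {x : ℝ}
    (hx : x ∈ Set.Ioo (0 : ℝ) 1) : connectionDefect δ x = 0 := by
  set F : ℝ → ℂ := fun t => connectionDefect δ t * Complex.exp (δ * (Real.log (1 - t) : ℂ)) with hF
  have hderiv : ∀ t ∈ Set.Ioo (0 : ℝ) 1, HasDerivAt F 0 t := by
    intro t ht
    have h1 : (1 : ℂ) - t ≠ 0 := by exact_mod_cast (sub_pos.mpr ht.2).ne'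
    have hl : HasDerivAt (fun t : ℝ => (Real.log (1 - t) : ℂ)) _ t :=
      (((hasDerivAt_id t).const_sub 1).log (sub_pos.mpr ht.2).ne').ofReal_comp
    have := (hasDerivAt_connectionDefect hδ ht).mul (hl.const_mul δ).cexp
    convert! this using 1
    push_cast
    simp only [id]
    field_simp
    ring
  have hconst : ∀ t ∈ Set.Ioo (0 : ℝ) 1, F t = F x := fun t ht =>
    isOpen_Ioo.is_const_of_deriv_eq_zero isPreconnected_Ioo
      (fun s hs => (hderiv s hs).differentiableAt.differentiableWithinAt)
      (fun s hs => (hderiv s hs).deriv) ht hx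
  have hlim : Tendsto F (𝓝[>] 0) (𝓝 0) := by
    have hc : ContinuousAt (fun t : ℝ => Complex.exp (δ * (Real.log (1 - t) : ℂ))) 0 := by
      have : ContinuousAt (fun t : ℝ => Real.log (1 - t)) 0 :=
        (continuousAt_const.sub continuousAt_id).log (by simp)
      fun_prop
    simpa [hF] using (tendsto_connectionDefect hδ).mul (hc.tendsto.mono_left nhdsWithin_le_nhds)
  have hIoo : ∀ᶠ t : ℝ in 𝓝[>] 0, t ∈ Set.Ioo (0 : ℝ) 1 := Ioo_mem_nhdsGT one_pos
  have hF0 : F x = 0 := tendsto_nhds_unique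
    (tendsto_const_nhds.congr' (hIoo.mono fun t ht => (hconst t ht).symm)) hlim
  exact (mul_eq_zero.mp hF0).resolve_right (Complex.exp_ne_zero _)

lemma F21_one_one_add (hδ : ∀ m : ℕ, δ ≠ -(m : ℂ)) (z : ℂ) :
    F21 δ 1 (1 + δ) z = δ * ∑' n : ℕ, 1 / (δ + n) * z ^ n := by
  rw [F21, ← tsum_mul_left]
  refine tsum_congr fun n => ?_
  have h1 : poch (1 + δ) n ≠ 0 := poch_ne_zero (fun m hm => hδ (m + 1) (by
    push_cast; linear_combination hm)) n
  have h2 : (n.factorial : ℂ) ≠ 0 := by exact_mod_cast n.factorial_ne_zero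
  have h3 := add_natCast_ne_zero hδ n
  have h4 := (poch_succ δ n).symm.trans (poch_succ' δ n)
  rw [poch_one, mul_div_mul_right _ _ h2, ← mul_assoc]
  congr 1
  rw [div_eq_iff h1]
  field_simp
  linear_combination h4

end Connection

/-- For `δ` not a nonpositive integer and `0 < x < 1`:
`Σ_n ((δ)_n/n!)(ψ(n+1) - ψ(δ+n) - ln x) x^n` converges absolutely and
`₂F₁(δ,1;1+δ;1-x) = δ·Σ`. -/
theorem stmt9 (δ : ℂ) (hδ : ∀ m : ℕ, δ ≠ -(m : ℂ)) (x : ℝ) (hx : x ∈ Set.Ioo (0 : ℝ) 1) :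
    Summable (fun n : ℕ => ‖poch δ n / (n.factorial : ℂ) *
      (digamma ((n : ℂ) + 1) - digamma (δ + n) - (Real.log x : ℂ)) * (x : ℂ) ^ n‖) ∧
    F21 δ 1 (1 + δ) (1 - (x : ℂ)) =
      δ * ∑' n : ℕ, poch δ n / (n.factorial : ℂ) *
        (digamma ((n : ℂ) + 1) - digamma (δ + n) - (Real.log x : ℂ)) * (x : ℂ) ^ n := by
  have hb := absConvOnDisk_binomCoeff hδ
  have hz := norm_ofReal_lt_one hx
  refine ⟨(hb.mul_of_tendsto ((tendsto_digamma_sub_digamma hδ).sub_const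
    (Real.log x : ℂ))).summable_norm hz, ?_⟩
  have hR := ((absConvOnDisk_digammaCoeff hδ).hasSum hz).sub
    ((hb.hasSum hz).mul_left (Real.log x : ℂ))
  rw [F21_one_one_add hδ, sub_eq_zero.mp (connectionDefect_eq_zero hδ hx), ← hR.tsum_eq]
  congr 1
  refine tsum_congr fun n => ?_
  simp only [digammaCoeff, binomCoeff]
  ring
end

section
/- Let D ≥ 2 be an integer and let a = (a_1, …, a_D) ∈ ℕ^D be a multi-index. Then the integral of the monomial x_1^{a_1}···x_D^{a_D} over the unit sphere S^{D−1} ⊂ ℝ^D with respect to the (D−1)-dimensional surface measure equals 2·(Π_{μ=1}^D Γ((a_μ+1)/2)) / Γ((Σ_{μ=1}^D a_μ + D)/2) if all a_μ are even, and equals 0 if at least one a_μ is odd. -/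
open MeasureTheory

/-- A Gaussian moment over the half-line, for natural exponents. -/
lemma integral_Ioi_pow_mul_exp_neg_sq (n : ℕ) :
    ∫ x in Set.Ioi (0 : ℝ), x ^ n * Real.exp (-x ^ 2) = Real.Gamma (((n : ℝ) + 1) / 2) / 2 := by
  have h := integral_rpow_mul_exp_neg_rpow (p := 2) (q := n) two_pos
    (by linarith [n.cast_nonneg (α := ℝ)])
  simp only [Real.rpow_natCast, Real.rpow_ofNat] at h
  rw [h]
  ring

/-- Moments of the Gaussian `exp (-x ^ 2)` on the real line. -/
lemma integral_pow_mul_exp_neg_sq (n : ℕ) :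
    ∫ x : ℝ, x ^ n * Real.exp (-x ^ 2) =
      if Even n then Real.Gamma (((n : ℝ) + 1) / 2) else 0 := by
  split_ifs with hn
  · have h := integral_comp_abs (f := fun x : ℝ ↦ x ^ n * Real.exp (-x ^ 2))
    simp only [hn.pow_abs, sq_abs] at h
    rw [h, integral_Ioi_pow_mul_exp_neg_sq]
    ring
  · have h := integral_neg_eq_self (fun x : ℝ ↦ x ^ n * Real.exp (-x ^ 2)) volume
    simp only [(Nat.not_even_iff_odd.1 hn).neg_pow, neg_sq, neg_mul, integral_neg] at h
    linarith

/-- Polar coordinates for the product of a function on the sphere and a radial function. -/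
lemma integral_eq_toSphere_mul_integral_Ioi {E : Type*} [NormedAddCommGroup E] [NormedSpace ℝ E]
    [Nontrivial E] [FiniteDimensional ℝ E] [MeasurableSpace E] [BorelSpace E]
    (μ : Measure E) [μ.IsAddHaarMeasure] (F : E → ℝ) (f : Metric.sphere (0 : E) 1 → ℝ) (g : ℝ → ℝ)
    (hF : ∀ (x : Metric.sphere (0 : E) 1) (r : ℝ), 0 < r → F (r • (x : E)) = f x * g r) :
    ∫ x, F x ∂μ = (∫ x, f x ∂μ.toSphere) *
      ∫ r in Set.Ioi (0 : ℝ), r ^ (Module.finrank ℝ E - 1) * g r := by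
  calc
    ∫ x, F x ∂μ = ∫ x : ({(0)}ᶜ : Set E), F x ∂(μ.comap (↑)) := by
      rw [integral_subtype_comap (measurableSet_singleton _).compl F, restrict_compl_singleton]
    _ = ∫ x, f x.1 * g x.2 ∂μ.toSphere.prod (.volumeIoiPow (Module.finrank ℝ E - 1)) := by
      rw [← μ.measurePreserving_homeomorphUnitSphereProd.integral_comp
        (Homeomorph.measurableEmbedding _)]
      refine integral_congr_ae (.of_forall fun x ↦ ?_)
      have hx : 0 < ‖(x : E)‖ := norm_pos_iff.2 x.2
      have h := hF (homeomorphUnitSphereProd E x).1 ‖(x : E)‖ hx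
      simp only [homeomorphUnitSphereProd_apply_fst_coe, smul_smul, mul_inv_cancel₀ hx.ne',
        one_smul] at h
      simpa using h
    _ = (∫ x, f x ∂μ.toSphere) *
        ∫ r : Set.Ioi (0 : ℝ), g r ∂.volumeIoiPow (Module.finrank ℝ E - 1) :=
      integral_prod_mul f fun r : Set.Ioi (0 : ℝ) ↦ g r
    _ = _ := by
      congr 1
      simp only [Measure.volumeIoiPow, ENNReal.ofReal]
      rw [integral_withDensity_eq_integral_smul,
        integral_subtype_comap measurableSet_Ioi
          fun r ↦ Real.toNNReal (r ^ (Module.finrank ℝ E - 1)) • g r,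
        setIntegral_congr_fun measurableSet_Ioi fun r hr ↦ ?_]
      · simp only [NNReal.smul_def, smul_eq_mul,
          Real.coe_toNNReal _ (pow_nonneg (Set.mem_Ioi.1 hr).le _)]
      · exact (measurable_subtype_coe.pow_const _).real_toNNReal

/-- The integral of a monomial against the Gaussian factorizes over the coordinates. -/
lemma integral_euclideanSpace_prod_pow_mul_exp_neg_norm_sq {ι : Type*} [Fintype ι] (a : ι → ℕ) :
    ∫ x : EuclideanSpace ℝ ι, (∏ i, x i ^ a i) * Real.exp (-‖x‖ ^ 2) =
      ∏ i, ∫ t : ℝ, t ^ a i * Real.exp (-t ^ 2) := by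
  rw [← integral_fintype_prod_volume_eq_prod (fun i (t : ℝ) ↦ t ^ a i * Real.exp (-t ^ 2)),
    ← (PiLp.volume_preserving_toLp ι).integral_comp
      (MeasurableEquiv.toLp 2 (ι → ℝ)).measurableEmbedding]
  simp [EuclideanSpace.real_norm_sq_eq, Finset.prod_mul_distrib, ← Real.exp_sum]

/-- Integral of a monomial over the unit sphere `S^{D-1} ⊂ ℝ^D` with respect to the
`(D-1)`-dimensional surface measure: it equals
`2·(Π_μ Γ((a_μ+1)/2))/Γ((Σ_μ a_μ + D)/2)` if all `a_μ` are even, and `0` otherwise. -/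
theorem stmt12 (D : ℕ) (hD : 2 ≤ D) (a : Fin D → ℕ) :
    (∫ x : Metric.sphere (0 : EuclideanSpace ℝ (Fin D)) 1,
        (∏ μ : Fin D, ((x : EuclideanSpace ℝ (Fin D)) μ) ^ (a μ))
        ∂((volume : Measure (EuclideanSpace ℝ (Fin D))).toSphere)) =
      if ∀ μ : Fin D, Even (a μ) then
        2 * (∏ μ : Fin D, Real.Gamma (((a μ : ℝ) + 1) / 2)) /
          Real.Gamma (((∑ μ : Fin D, (a μ : ℝ)) + D) / 2)
      else 0 := by
  have : Nonempty (Fin D) := ⟨⟨0, by lia⟩⟩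
  have hpolar := integral_eq_toSphere_mul_integral_Ioi
    (volume : Measure (EuclideanSpace ℝ (Fin D)))
    (fun x ↦ (∏ i, x i ^ a i) * Real.exp (-‖x‖ ^ 2))
    (fun x ↦ ∏ i, (x : EuclideanSpace ℝ (Fin D)) i ^ a i)
    (fun r ↦ r ^ (∑ i, a i) * Real.exp (-r ^ 2)) (fun x r hr ↦ by
      simp only [PiLp.smul_apply, smul_eq_mul, mul_pow, Finset.prod_mul_distrib,
        Finset.prod_pow_eq_pow_sum, norm_smul, norm_eq_of_mem_sphere, Real.norm_eq_abs, sq_abs]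
      ring_nf)
  rw [integral_euclideanSpace_prod_pow_mul_exp_neg_norm_sq] at hpolar
  simp only [integral_pow_mul_exp_neg_sq, finrank_euclideanSpace_fin, ← mul_assoc, ← pow_add,
    integral_Ioi_pow_mul_exp_neg_sq] at hpolar
  have hcast : (((D - 1 + ∑ i, a i : ℕ) : ℝ) + 1) / 2 = ((∑ i, (a i : ℝ)) + D) / 2 := by
    push_cast [Nat.cast_sub (show 1 ≤ D by lia)]
    ring
  rw [hcast] at hpolar
  have hΓ : 0 < Real.Gamma (((∑ i, (a i : ℝ)) + D) / 2) :=
    Real.Gamma_pos_of_pos (by positivity)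
  split_ifs with ha
  · simp only [ha, if_true] at hpolar
    rw [hpolar]
    field_simp
  · obtain ⟨i, hi⟩ := not_forall.1 ha
    rw [Finset.prod_eq_zero (Finset.mem_univ i) (if_neg hi)] at hpolar
    exact (mul_eq_zero.1 hpolar.symm).resolve_right (by positivity)
end

section
/- Let D ≥ 2 and l ≥ 1 be integers. The complex vector space of polynomials p in D variables that are homogeneous of degree l and harmonic (i.e., Δp = 0, where Δ = Σ_{μ=1}^D ∂²/∂x_μ² is the Laplacian) has dimension N(l,D) = (2l+D−2)·(l+D−3)! / ((D−2)!·l!). -/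
/-- The Laplacian `Δ = Σ_μ ∂²/∂x_μ²` on polynomials in `D` variables, as a linear map. -/
noncomputable def polyLaplacian (D : ℕ) :
    MvPolynomial (Fin D) ℂ →ₗ[ℂ] MvPolynomial (Fin D) ℂ :=
  ∑ μ : Fin D, ((MvPolynomial.pderiv μ).toLinearMap ∘ₗ (MvPolynomial.pderiv μ).toLinearMap)

theorem finrank_homogeneousSubmodule (D n : ℕ) :
    Module.finrank ℂ (MvPolynomial.homogeneousSubmodule (Fin D) ℂ n) = (D + n - 1).choose n := by
  rw [MvPolynomial.homogeneousSubmodule_eq_finsupp_supported]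
  have hset : {d : Fin D →₀ ℕ | d.degree = n} =
      (Finset.univ.finsuppAntidiag n : Finset (Fin D →₀ ℕ)) := by
    ext d
    simp [Finsupp.degree_eq_sum]
  rw [hset, (AddMonoidAlgebra.supportedEquivFinsupp _).finrank_eq, Module.finrank_finsupp_self]
  simp [Finset.card_finsuppAntidiag_nat_eq_choose]

theorem finrank_map_add_finrank_inf_ker {K V W : Type*} [Field K] [AddCommGroup V] [Module K V]
    [AddCommGroup W] [Module K W] (f : V →ₗ[K] W) (p : Submodule K V) [FiniteDimensional K p] :
    Module.finrank K (p.map f) + Module.finrank K ↥(p ⊓ LinearMap.ker f) = Module.finrank K p := by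
  rw [← (f.domRestrict p).finrank_range_add_finrank_ker, LinearMap.range_domRestrict,
    LinearMap.ker_domRestrict, ← Submodule.map_comap_subtype, Submodule.finrank_map_subtype_eq]

theorem polyLaplacian_apply {D : ℕ} (p : MvPolynomial (Fin D) ℂ) :
    polyLaplacian D p = ∑ μ, MvPolynomial.pderiv μ (MvPolynomial.pderiv μ p) := by
  simp [polyLaplacian]

theorem isHomogeneous_polyLaplacian {D n : ℕ} {p : MvPolynomial (Fin D) ℂ}
    (hp : p.IsHomogeneous n) : (polyLaplacian D p).IsHomogeneous (n - 2) := by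
  rw [polyLaplacian_apply]
  exact MvPolynomial.IsHomogeneous.sum _ _ _ fun _ _ => hp.pderiv.pderiv

theorem polyLaplacian_eq_zero_of_isHomogeneous_one {D : ℕ} {p : MvPolynomial (Fin D) ℂ}
    (hp : p.IsHomogeneous 1) : polyLaplacian D p = 0 := by
  rw [polyLaplacian_apply]
  refine Finset.sum_eq_zero fun μ _ => ?_
  rw [(MvPolynomial.totalDegree_eq_zero_iff_eq_C).1
    (Nat.le_zero.1 (hp.pderiv (i := μ)).totalDegree_le), MvPolynomial.pderiv_C]

theorem pderiv_pderiv_monomial {R σ : Type*} [CommSemiring R] (i : σ) (d : σ →₀ ℕ) (c : R) :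
    MvPolynomial.pderiv i (MvPolynomial.pderiv i (MvPolynomial.monomial d c)) =
      MvPolynomial.monomial (d - Finsupp.single i 2) (c * (d i * (d i - 1 : ℕ))) := by
  rw [MvPolynomial.pderiv_monomial, MvPolynomial.pderiv_monomial, tsub_tsub,
    ← Finsupp.single_add]
  simp [mul_assoc]

/-- Every monomial is a Laplacian, by induction on its degree in the variables other than `i`. -/
theorem monomial_mem_map_polyLaplacian {D : ℕ} (i : Fin D) (n k : ℕ) (d : Fin D →₀ ℕ)
    (hd : d.degree = n) (hk : n - d i = k) (c : ℂ) :
    MvPolynomial.monomial d c ∈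
      (MvPolynomial.homogeneousSubmodule (Fin D) ℂ (n + 2)).map (polyLaplacian D) := by
  induction k using Nat.strong_induction_on generalizing d c with
  | _ k ih =>
    set S := (MvPolynomial.homogeneousSubmodule (Fin D) ℂ (n + 2)).map (polyLaplacian D)
    set e := d + Finsupp.single i 2 with he
    have hei : e i = d i + 2 := by simp [he]
    have hdeg : e.degree = n + 2 := by simp [he, hd]
    set a : ℂ := e i * (e i - 1 : ℕ)
    have ha : a ≠ 0 := by
      simp only [a, hei, ne_eq, mul_eq_zero, Nat.cast_eq_zero]
      omega
    have hmem : polyLaplacian D (MvPolynomial.monomial e (c / a)) ∈ S :=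
      Submodule.mem_map_of_mem (MvPolynomial.isHomogeneous_monomial _ hdeg)
    rw [polyLaplacian_apply, ← Finset.add_sum_erase _ _ (Finset.mem_univ i),
      pderiv_pderiv_monomial, div_mul_cancel₀ c ha, he, add_tsub_cancel_right] at hmem
    refine (Submodule.add_mem_iff_left S (Submodule.sum_mem _ fun j hj => ?_)).1 hmem
    have hji : j ≠ i := Finset.ne_of_mem_erase hj
    have hej : e j = d j := by simp [he, hji.symm]
    rw [pderiv_pderiv_monomial, ← he]
    by_cases h2 : 2 ≤ d j
    · have hle : Finsupp.single j 2 ≤ e := by simpa [hej] using h2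
      have hdeg' : (e - Finsupp.single j 2).degree = n := by
        have := congrArg Finsupp.degree (tsub_add_cancel_of_le hle)
        simp only [map_add, Finsupp.degree_single] at this
        omega
      have hi : (e - Finsupp.single j 2 : Fin D →₀ ℕ) i = d i + 2 := by simp [hei, hji]
      have hlt : d i < n := by
        have := Finsupp.le_degree i (e - Finsupp.single j 2)
        omega
      exact ih _ (by omega) _ hdeg' rfl _
    · have : (d j : ℂ) * (d j - 1 : ℕ) = 0 := by
        rw [mul_eq_zero, Nat.cast_eq_zero, Nat.cast_eq_zero]
        omega
      rw [hej, this, mul_zero, map_zero]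
      exact S.zero_mem

theorem map_polyLaplacian_homogeneousSubmodule {D : ℕ} (i : Fin D) (n : ℕ) :
    (MvPolynomial.homogeneousSubmodule (Fin D) ℂ (n + 2)).map (polyLaplacian D) =
      MvPolynomial.homogeneousSubmodule (Fin D) ℂ n := by
  apply le_antisymm
  · rintro _ ⟨p, hp, rfl⟩
    exact isHomogeneous_polyLaplacian hp
  · intro p hp
    rw [p.as_sum]
    refine Submodule.sum_mem _ fun d hd => monomial_mem_map_polyLaplacian i n _ d ?_ rfl _
    rw [Finsupp.degree_eq_weight_one]
    exact hp (MvPolynomial.mem_support_iff.1 hd)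

theorem choose_sub_choose_eq (m n : ℕ) :
    ((m + n + 3).choose (n + 2) : ℚ) - (m + n + 1).choose n =
      (2 * n + m + 4) * (m + n + 1).factorial / (m.factorial * (n + 2).factorial) := by
  rw [show m + n + 3 = (n + 2) + (m + 1) by ring, show m + n + 1 = n + (m + 1) by ring,
    Nat.cast_add_choose, Nat.cast_add_choose, show n + 2 + (m + 1) = n + (m + 1) + 1 + 1 by ring]
  simp only [Nat.factorial_succ (n + (m + 1) + 1), Nat.factorial_succ (n + (m + 1)),
    Nat.factorial_succ m, Nat.factorial_succ (n + 1), Nat.factorial_succ n]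
  push_cast
  field_simp
  ring

/-- The complex vector space of harmonic polynomials in `D ≥ 2` variables, homogeneous of
degree `l ≥ 1`, has dimension `N(l,D) = (2l+D-2)·(l+D-3)!/((D-2)!·l!)`. -/
theorem stmt14 (D l : ℕ) (hD : 2 ≤ D) (hl : 1 ≤ l) :
    (Module.finrank ℂ
        ↥(MvPolynomial.homogeneousSubmodule (Fin D) ℂ l ⊓ LinearMap.ker (polyLaplacian D)) : ℚ) =
      (2 * l + D - 2) * (l + D - 3).factorial / ((D - 2).factorial * l.factorial) := by
  obtain ⟨m, rfl⟩ := Nat.exists_eq_add_of_le' hD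
  obtain rfl | ⟨n, rfl⟩ : l = 1 ∨ ∃ n, l = n + 2 := by
    obtain h | h := hl.eq_or_lt
    · exact .inl h.symm
    · exact .inr (Nat.exists_eq_add_of_le' h)
  · rw [inf_eq_left.2 fun p hp => polyLaplacian_eq_zero_of_isHomogeneous_one hp,
      finrank_homogeneousSubmodule, show 1 + (m + 2) - 3 = m by omega]
    simp only [Nat.add_sub_cancel, Nat.choose_one_right, Nat.factorial_one]
    push_cast
    field_simp
    ring
  · have : FiniteDimensional ℂ (MvPolynomial.homogeneousSubmodule (Fin (m + 2)) ℂ (n + 2)) :=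
      Module.Finite.iff_fg.2 (MvPolynomial.homogeneousSubmodule_fg _ _ _)
    have h := finrank_map_add_finrank_inf_ker (polyLaplacian (m + 2))
      (MvPolynomial.homogeneousSubmodule (Fin (m + 2)) ℂ (n + 2))
    rw [map_polyLaplacian_homogeneousSubmodule 0, finrank_homogeneousSubmodule,
      finrank_homogeneousSubmodule, show m + 2 + n - 1 = m + n + 1 by omega,
      show m + 2 + (n + 2) - 1 = m + n + 3 by omega,
      ← Nat.cast_inj (R := ℚ), Nat.cast_add] at h
    rw [show n + 2 + (m + 2) - 3 = m + n + 1 by omega, Nat.add_sub_cancel,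
      eq_sub_of_add_eq' h, choose_sub_choose_eq]
    push_cast
    ring
end
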